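/- A passive seeded Tile Automata system with fewer than n states cannot non-committally simulate the system X_n. -/

import Mathlib

open scoped Classical

/-- Positions in the plane. -/
abbrev Pos : Type := ℤ × ℤ

/-- An assembly: a finite partial placement of states (encoded as naturals) on `ℤ²`. -/
structure Assembly where
  tiles : Pos → Option ℕ
  finite : {p : Pos | tiles p ≠ none}.Finite

/-- A transition rule `((σ1, σ2), (σ3, σ4), d)`; `d = true` is horizontal
(first state west), `d = false` is vertical (first state north). -/
abbrev Rule : Type := (ℕ × ℕ) × (ℕ × ℕ) × Bool

/-- The neighbour of `p` in orientation `d` (east for horizontal, south for vertical). -/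
def nbr (p : Pos) (d : Bool) : Pos := if d then (p.1 + 1, p.2) else (p.1, p.2 - 1)

/-- The bond strength contributed by the ordered pair of positions `p`, `q` in `A`. -/
def bond (aff : ℕ → ℕ → Bool → ℕ) (A : Assembly) (p q : Pos) : ℕ :=
  match A.tiles p, A.tiles q with
  | some σ1, some σ2 =>
      (if q = nbr p true then aff σ1 σ2 true else 0) +
      (if q = nbr p false then aff σ1 σ2 false else 0)
  | _, _ => 0

/-- The total weight of the cut `S` in the bond graph of `A`. -/
noncomputable def cutWeight (aff : ℕ → ℕ → Bool → ℕ) (A : Assembly) (S : Set Pos) : ℕ :=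
  ∑ p ∈ A.finite.toFinset, ∑ q ∈ A.finite.toFinset,
    if p ∈ S ∧ q ∉ S then bond aff A p q + bond aff A q p else 0

/-- `A` is `τ`-stable: every cut separating the tiles of `A` has weight at least `τ`. -/
def StableAt (aff : ℕ → ℕ → Bool → ℕ) (τ : ℕ) (A : Assembly) : Prop :=
  ∀ S : Set Pos,
    (∃ p, A.tiles p ≠ none ∧ p ∈ S) → (∃ p, A.tiles p ≠ none ∧ p ∉ S) →
    τ ≤ cutWeight aff A S

/-- A transition rule is affinity strengthening: it maintains or increases the
affinity of the transitioning pair and of every other potential neighbour. -/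
def Strengthening (aff : ℕ → ℕ → Bool → ℕ) (r : Rule) : Prop :=
  aff r.1.1 r.1.2 r.2.2 ≤ aff r.2.1.1 r.2.1.2 r.2.2 ∧
  ∀ (σ : ℕ) (d : Bool),
    aff r.1.1 σ d ≤ aff r.2.1.1 σ d ∧ aff σ r.1.1 d ≤ aff σ r.2.1.1 d ∧
    aff r.1.2 σ d ≤ aff r.2.1.2 σ d ∧ aff σ r.1.2 d ≤ aff σ r.2.1.2 d

/-- A seeded Tile Automata system `(Σ, Λ, Π, Δ, s, τ)`. -/
structure TASystem where
  states : Finset ℕ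
  initial : Finset ℕ
  aff : ℕ → ℕ → Bool → ℕ
  rules : Finset Rule
  seed : Assembly
  temp : ℕ
  temp_pos : 0 < temp
  initial_sub : initial ⊆ states
  seed_states : ∀ p σ, seed.tiles p = some σ → σ ∈ states
  seed_stable : StableAt aff temp seed
  rules_strengthening : ∀ r ∈ rules, Strengthening aff r
  rules_states : ∀ r ∈ rules,
    r.1.1 ∈ states ∧ r.1.2 ∈ states ∧ r.2.1.1 ∈ states ∧ r.2.1.2 ∈ states

/-- A single-tile attachment step. -/
def AttachStep (Γ : TASystem) (A B : Assembly) : Prop :=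
  ∃ (p : Pos) (σ : ℕ), σ ∈ Γ.initial ∧ A.tiles p = none ∧
    B.tiles = Function.update A.tiles p (some σ) ∧
    StableAt Γ.aff Γ.temp B

/-- A pairwise transition step. -/
def TransStep (Γ : TASystem) (A B : Assembly) : Prop :=
  ∃ r ∈ Γ.rules, ∃ p : Pos,
    A.tiles p = some r.1.1 ∧ A.tiles (nbr p r.2.2) = some r.1.2 ∧
    B.tiles = Function.update (Function.update A.tiles p (some r.2.1.1))
      (nbr p r.2.2) (some r.2.1.2)

/-- A single production step `A →^Γ_1 B`. -/
def Step (Γ : TASystem) (A B : Assembly) : Prop := AttachStep Γ A B ∨ TransStep Γ A B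

/-- `A →^Γ B`: reflexive-transitive closure of single steps. -/
def Reach (Γ : TASystem) : Assembly → Assembly → Prop := Relation.ReflTransGen (Step Γ)

/-- The producible assemblies of `Γ`. -/
def Producible (Γ : TASystem) (A : Assembly) : Prop := Reach Γ Γ.seed A

/-- `m`-blocks over (ℕ-encoded) states. -/
abbrev Block (m : ℕ) : Type := Fin m × Fin m → Option ℕ

def emptyBlock (m : ℕ) : Block m := fun _ => none

/-- A valid `m`-block representation function maps the empty block to empty. -/
def RepFun (m : ℕ) (R : Block m → Option ℕ) : Prop :=
  0 < m ∧ R (emptyBlock m) = none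

/-- The `m`-block of `A` with block coordinates `(x, y)`. -/
def blockAt (m : ℕ) (A : Assembly) (x y : ℤ) : Block m :=
  fun ij => A.tiles ((m : ℤ) * x + (ij.1.1 : ℤ), (m : ℤ) * y + (ij.2.1 : ℤ))

/-- `B = R*(A)`: the blockwise image of `A` under `R`. -/
def RepMap (m : ℕ) (R : Block m → Option ℕ) (A B : Assembly) : Prop :=
  ∀ x y : ℤ, B.tiles (x, y) = R (blockAt m A x y)

/-- Condition 1 of equivalent productions: `{R*(A') : A' ∈ PROD_{Γ_S}} = PROD_{Γ_T}`. -/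
def EquivProdSet (m : ℕ) (R : Block m → Option ℕ) (ΓS ΓT : TASystem) : Prop :=
  (∀ A', Producible ΓS A' → ∃ A, Producible ΓT A ∧ RepMap m R A' A) ∧
  (∀ A, Producible ΓT A → ∃ A', Producible ΓS A' ∧ RepMap m R A' A)

/-- `Γ_S` achieves `c`-fuzz under `R*`. -/
def AchievesFuzz (m : ℕ) (R : Block m → Option ℕ) (ΓS : TASystem) (c : ℕ) : Prop :=
  ∀ A', Producible ΓS A' → ∀ x y : ℤ,
    blockAt m A' x y ≠ emptyBlock m → R (blockAt m A' x y) = none →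
    ∃ u v : ℤ, |u| ≤ (c : ℤ) ∧ |v| ≤ (c : ℤ) ∧ R (blockAt m A' (x + u) (y + v)) ≠ none

/-- `Γ_T` follows `Γ_S` under `R`. -/
def Follows (m : ℕ) (R : Block m → Option ℕ) (ΓS ΓT : TASystem) : Prop :=
  ∀ A' B', Producible ΓS A' → Reach ΓS A' B' →
    ∀ A B, RepMap m R A' A → RepMap m R B' B → Reach ΓT A B

/-- `Γ_S` non-committally models `Γ_T` under `R`. -/
def Models (m : ℕ) (R : Block m → Option ℕ) (ΓS ΓT : TASystem) : Prop :=
  ∀ A B, Producible ΓT A → Reach ΓT A B →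
    ∀ A', Producible ΓS A' → RepMap m R A' A →
      ∃ B', Reach ΓS A' B' ∧ RepMap m R B' B

/-- `Γ_S` non-committally simulates `Γ_T` under `R` with fuzz bound `c`. -/
def SimulatesFuzz (m : ℕ) (R : Block m → Option ℕ) (ΓS ΓT : TASystem) (c : ℕ) : Prop :=
  RepFun m R ∧ EquivProdSet m R ΓS ΓT ∧ AchievesFuzz m R ΓS c ∧
  Follows m R ΓS ΓT ∧ Models m R ΓS ΓT

/-- `Γ_S` non-committally simulates `Γ_T` under `R` (with some fuzz bound). -/
def Simulates (m : ℕ) (R : Block m → Option ℕ) (ΓS ΓT : TASystem) : Prop :=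
  ∃ c : ℕ, 0 < c ∧ SimulatesFuzz m R ΓS ΓT c
/-- The assembly consisting of a single tile in state `σ` at `p₀`. -/
def onePoint (p₀ : Pos) (σ : ℕ) : Assembly where
  tiles := fun p => if p = p₀ then some σ else none
  finite := Set.Finite.subset (Set.finite_singleton p₀) (by
    intro p hp
    simp only [Set.mem_setOf_eq] at hp
    by_contra h
    simp only [Set.mem_singleton_iff] at h
    rw [if_neg h] at hp
    exact hp rfl)

/-- The seed assembly of `X_n`: a single tile in state `S` (encoded as `0`) at the origin. -/
def seedX : Assembly := onePoint ((0 : ℤ), (0 : ℤ)) 0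

/-- The assembly `s · a_i`: the seed tile with a tile in state `a_i` (encoded as `i`)
attached to its east. -/
def seedDot (i : ℕ) : Assembly where
  tiles := fun p =>
    if p = ((0 : ℤ), (0 : ℤ)) then some 0
    else if p = ((1 : ℤ), (0 : ℤ)) then some i else none
  finite := Set.Finite.subset
      ((Set.finite_singleton ((0 : ℤ), (0 : ℤ))).insert ((1 : ℤ), (0 : ℤ))) (by
    intro p hp
    simp only [Set.mem_setOf_eq] at hp
    by_contra h
    simp only [Set.mem_insert_iff, Set.mem_singleton_iff] at h
    push_neg at h
    rw [if_neg h.2, if_neg h.1] at hp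
    exact hp rfl)

/-- The passive system `X_n`: states `S = 0` and `a_1, …, a_n`, seed a single `S` tile,
east–west affinity of strength `τ = 1` between `S` and each `a_i`, no transition rules. -/
noncomputable def X (n : ℕ) : TASystem where
  states := Finset.range (n + 1)
  initial := Finset.Icc 1 n
  aff := fun x y d =>
    if d = true ∧ ((x = 0 ∧ 1 ≤ y ∧ y ≤ n) ∨ (y = 0 ∧ 1 ≤ x ∧ x ≤ n)) then 1 else 0
  rules := ∅
  seed := seedX
  temp := 1
  temp_pos := Nat.one_pos
  initial_sub := by
    intro x hx
    simp only [Finset.mem_Icc] at hx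
    simp only [Finset.mem_range]
    omega
  seed_states := by
    intro p σ h
    simp only [seedX, onePoint] at h
    by_cases hp : p = ((0 : ℤ), (0 : ℤ))
    · rw [if_pos hp] at h
      simp only [Option.some.injEq] at h
      simp only [Finset.mem_range]
      omega
    · rw [if_neg hp] at h
      exact absurd h (by simp)
  seed_stable := by
    rintro S ⟨p, hp, hpS⟩ ⟨q, hq, hqS⟩
    exfalso
    have hp' : p = ((0 : ℤ), (0 : ℤ)) := by
      by_contra h
      apply hp
      simp only [seedX, onePoint]
      rw [if_neg h]
    have hq' : q = ((0 : ℤ), (0 : ℤ)) := by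
      by_contra h
      apply hq
      simp only [seedX, onePoint]
      rw [if_neg h]
    rw [hp'] at hpS
    rw [hq'] at hqS
    exact hqS hpS
  rules_strengthening := by intro r hr; simp at hr
  rules_states := by intro r hr; simp at hr

/-- `Γ` is a `k`-burnout system: in any production sequence from the seed,
each tile changes its state at most `k` times. -/
def Burnout (Γ : TASystem) (k : ℕ) : Prop :=
  ∀ (N : ℕ) (seq : Fin (N + 1) → Assembly), seq 0 = Γ.seed →
    (∀ i : Fin N, Step Γ (seq i.castSucc) (seq i.succ)) →
    ∀ p : Pos,
      (Finset.univ.filter (fun i : Fin N =>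
        (seq i.castSucc).tiles p ≠ none ∧
        (seq i.succ).tiles p ≠ (seq i.castSucc).tiles p)).card ≤ k

/-- A bounded system: `k`-burnout for some `k`. -/
def Bounded (Γ : TASystem) : Prop := ∃ k : ℕ, Burnout Γ k

/-- A passive system: `0`-burnout. -/
def Passive (Γ : TASystem) : Prop := Burnout Γ 0

theorem Assembly.ext_tiles {A B : Assembly} (h : A.tiles = B.tiles) : A = B := by
  cases A; cases B; simp_all

def SubAsm (A B : Assembly) : Prop := ∀ p σ, A.tiles p = some σ → B.tiles p = some σ

theorem bond_mono (aff) {A B : Assembly} (h : SubAsm A B) (p q : Pos) :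
    bond aff A p q ≤ bond aff B p q := by
  rcases hp : A.tiles p with _ | a
  · simp [bond, hp]
  rcases hq : A.tiles q with _ | b
  · simp [bond, hp, hq]
  simp [bond, hp, hq, h _ _ hp, h _ _ hq]

theorem supp_mono {A B : Assembly} (h : SubAsm A B) :
    A.finite.toFinset ⊆ B.finite.toFinset := by
  intro p hp
  simp only [Set.Finite.mem_toFinset, Set.mem_setOf_eq] at hp ⊢
  obtain ⟨a, ha⟩ := Option.ne_none_iff_exists'.1 hp
  simp [h _ _ ha]

theorem cut_mono (aff) {A B : Assembly} (h : SubAsm A B) (S : Set Pos) :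
    cutWeight aff A S ≤ cutWeight aff B S := by
  unfold cutWeight
  refine le_trans (Finset.sum_le_sum fun p _ => ?_)
    (Finset.sum_le_sum_of_subset (supp_mono h))
  refine le_trans (Finset.sum_le_sum fun q _ => ?_)
    (Finset.sum_le_sum_of_subset (supp_mono h))
  have := bond_mono aff h p q
  have := bond_mono aff h q p
  split_ifs <;> omega

theorem le_cut (aff) (A : Assembly) (S : Set Pos) {p q : Pos} (hp : A.tiles p ≠ none)
    (hq : A.tiles q ≠ none) (hpS : p ∈ S) (hqS : q ∉ S) :
    bond aff A p q + bond aff A q p ≤ cutWeight aff A S := by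
  unfold cutWeight
  have h1 := Finset.single_le_sum (s := A.finite.toFinset)
    (f := fun p => ∑ q ∈ A.finite.toFinset,
      if p ∈ S ∧ q ∉ S then bond aff A p q + bond aff A q p else 0)
    (fun _ _ => Nat.zero_le _) (a := p) (by simpa using hp)
  have h2 := Finset.single_le_sum (s := A.finite.toFinset)
    (f := fun q => if p ∈ S ∧ q ∉ S then bond aff A p q + bond aff A q p else 0)
    (fun _ _ => Nat.zero_le _) (a := q) (by simpa using hq)
  refine le_trans ?_ h1
  refine le_trans ?_ h2
  simp [hpS, hqS]

theorem seedDot_reach (n i : ℕ) (h1 : 1 ≤ i) (h2 : i ≤ n) : Reach (X n) seedX (seedDot i) := by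
  refine Relation.ReflTransGen.single (Or.inl ⟨(1, 0), i, ?_, ?_, ?_, ?_⟩)
  · simp [X, h1, h2]
  · simp [seedX, onePoint]
  · funext p
    by_cases hp : p = (1, 0)
    · subst hp; simp [seedDot]
    · simp [seedDot, seedX, onePoint, hp, Function.update]
  · have hb : 1 ≤ bond (X n).aff (seedDot i) (0, 0) (1, 0) := by
      simp [bond, seedDot, X, nbr, h1, h2]
    have key : ∀ p, (seedDot i).tiles p ≠ none → p = (0, 0) ∨ p = (1, 0) := by
      intro p hp
      by_contra hc
      push Not at hc
      simp [seedDot, hc.1, hc.2] at hp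
    have t0 : (seedDot i).tiles (0, 0) ≠ none := by simp [seedDot]
    have t1 : (seedDot i).tiles (1, 0) ≠ none := by simp [seedDot]
    rintro S ⟨p, hp, hpS⟩ ⟨q, hq, hqS⟩
    change 1 ≤ _
    rcases key p hp with rfl | rfl <;> rcases key q hq with rfl | rfl
    · exact absurd hpS hqS
    · have := le_cut (X n).aff (seedDot i) S hp hq hpS hqS
      omega
    · have := le_cut (X n).aff (seedDot i) S hp hq hpS hqS
      omega
    · exact absurd hpS hqS

theorem attach_sub {Γ : TASystem} {A B : Assembly} (h : AttachStep Γ A B) : SubAsm A B := by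
  obtain ⟨p, σ, -, hn, hB, -⟩ := h
  intro q s hq
  rw [hB, Function.update_apply]
  split_ifs with h
  · subst h; simp [hn] at hq
  · exact hq

theorem X_sub {n : ℕ} {A B : Assembly} (h : Reach (X n) A B) : SubAsm A B := by
  induction h with
  | refl => intro p σ h; exact h
  | tail _ hs ih =>
    rcases hs with hs | ⟨r, hr, -⟩
    · exact fun p σ h => attach_sub hs p σ (ih p σ h)
    · simp [X] at hr

theorem exists_seq {Γ : TASystem} {A : Assembly} (h : Producible Γ A) :
    ∃ (N : ℕ) (f : ℕ → Assembly), f 0 = Γ.seed ∧ f N = A ∧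
      ∀ i < N, Step Γ (f i) (f (i + 1)) := by
  unfold Producible Reach at h
  induction h with
  | refl => exact ⟨0, fun _ => Γ.seed, rfl, rfl, by simp⟩
  | @tail B C _ hs ih =>
    obtain ⟨N, f, h0, hN, hf⟩ := ih
    refine ⟨N + 1, fun k => if k ≤ N then f k else C, by simp [h0], by simp, ?_⟩
    intro i hi
    rcases Nat.lt_or_ge i N with h | h
    · have : i + 1 ≤ N := h
      simpa [h.le, this] using hf i h
    · have : i = N := by omega
      subst this
      simpa [hN] using hs

theorem passive_step {Γ : TASystem} (hP : Passive Γ) {A B : Assembly} (hA : Producible Γ A)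
    (hs : Step Γ A B) {p : Pos} (hp : A.tiles p ≠ none) : B.tiles p = A.tiles p := by
  obtain ⟨N, f, h0, hN, hf⟩ := exists_seq hA
  let g : ℕ → Assembly := fun k => if k ≤ N then f k else B
  have hg : ∀ i < N + 1, Step Γ (g i) (g (i + 1)) := by
    intro i hi
    rcases Nat.lt_or_ge i N with h | h
    · have : i + 1 ≤ N := h
      simpa [g, h.le, this] using hf i h
    · have : i = N := by omega
      subst this
      simpa [g, hN] using hs
  have := hP (N + 1) (fun k => g k.1) (by simp [g, h0])
    (fun i => by simpa using hg i.1 i.2) p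
  rw [Nat.le_zero, Finset.card_eq_zero, Finset.filter_eq_empty_iff] at this
  have h := this (Finset.mem_univ (Fin.last N))
  simp only [Fin.val_castSucc, Fin.val_last, Fin.val_succ] at h
  have e1 : g N = A := by simp [g, hN]
  have e2 : g (N + 1) = B := by simp [g]
  rw [e1, e2] at h
  by_contra hc
  exact h ⟨hp, hc⟩

theorem passive_trans {Γ : TASystem} (hP : Passive Γ) {A B : Assembly} (hA : Producible Γ A)
    (hs : TransStep Γ A B) : B = A := by
  apply Assembly.ext_tiles
  funext q
  by_cases hq : A.tiles q = none
  · obtain ⟨r, -, p, h1, h2, hB⟩ := hs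
    have n1 : q ≠ nbr p r.2.2 := by rintro rfl; simp [hq] at h2
    have n2 : q ≠ p := by rintro rfl; simp [hq] at h1
    rw [hB, Function.update_of_ne n1, Function.update_of_ne n2]
  · exact passive_step hP hA (Or.inr hs) hq

theorem first_attach {Γ : TASystem} (hP : Passive Γ) {A B : Assembly} (hA : Producible Γ A)
    (h : Reach Γ A B) (hne : A ≠ B) : ∃ C, AttachStep Γ A C ∧ Reach Γ C B := by
  unfold Reach at h
  induction h using Relation.ReflTransGen.head_induction_on with
  | refl => exact absurd rfl hne
  | head hs hr ih =>
    rcases hs with hs | hs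
    · exact ⟨_, hs, hr⟩
    · have := passive_trans hP hA hs
      subst this
      exact ih hA hne

noncomputable def addTile (A : Assembly) (p : Pos) (σ : ℕ) : Assembly where
  tiles := Function.update A.tiles p (some σ)
  finite := (A.finite.insert p).subset (by
    intro q hq
    by_cases h : q = p
    · exact Or.inl h
    · right
      simpa [Function.update_of_ne h] using hq)

theorem stable_union {aff : ℕ → ℕ → Bool → ℕ} {τ : ℕ} {B C D : Assembly} {o : Pos}
    (hB : StableAt aff τ B) (hC : StableAt aff τ C) (hBD : SubAsm B D) (hCD : SubAsm C D)
    (oB : B.tiles o ≠ none) (oC : C.tiles o ≠ none)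
    (hD : ∀ p, D.tiles p ≠ none → B.tiles p ≠ none ∨ C.tiles p ≠ none) :
    StableAt aff τ D := by
  rintro S ⟨p, hp, hpS⟩ ⟨q, hq, hqS⟩
  by_cases ho : o ∈ S
  · rcases hD q hq with h | h
    · exact (hB S ⟨o, oB, ho⟩ ⟨q, h, hqS⟩).trans (cut_mono aff hBD S)
    · exact (hC S ⟨o, oC, ho⟩ ⟨q, h, hqS⟩).trans (cut_mono aff hCD S)
  · rcases hD p hp with h | h
    · exact (hB S ⟨p, h, hpS⟩ ⟨o, oB, ho⟩).trans (cut_mono aff hBD S)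
    · exact (hC S ⟨p, h, hpS⟩ ⟨o, oC, ho⟩).trans (cut_mono aff hCD S)

theorem bounded_supp {m c : ℕ} {R : Block m → Option ℕ} {Y : TASystem} (hR : RepFun m R)
    (hF : AchievesFuzz m R Y c) {A : Assembly} (hA : Producible Y A)
    (hM : RepMap m R A seedX) :
    A.finite.toFinset ⊆ Finset.Icc (-(m * c : ℤ)) (m * c + m) ×ˢ
      Finset.Icc (-(m * c : ℤ)) (m * c + m) := by
  rintro ⟨a, b⟩ hp
  simp only [Set.Finite.mem_toFinset, Set.mem_setOf_eq] at hp
  have hm : (0 : ℤ) < m := by exact_mod_cast hR.1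
  have key : ∀ x y : ℤ, R (blockAt m A x y) ≠ none → x = 0 ∧ y = 0 := by
    intro x y h
    rw [← hM x y] at h
    by_contra hc
    apply h
    simp [seedX, onePoint, hc]
  have hne : blockAt m A (a / m) (b / m) ≠ emptyBlock m := by
    intro h
    have ha := Int.emod_nonneg a hm.ne'
    have hb := Int.emod_nonneg b hm.ne'
    have ha' := Int.emod_lt_of_pos a hm
    have hb' := Int.emod_lt_of_pos b hm
    have := congrFun h (⟨(a % m).toNat, by omega⟩, ⟨(b % m).toNat, by omega⟩)
    simp only [blockAt, emptyBlock, Int.toNat_of_nonneg ha, Int.toNat_of_nonneg hb,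
      Int.mul_ediv_add_emod] at this
    exact hp this
  have hc : |a / (m : ℤ)| ≤ c ∧ |b / (m : ℤ)| ≤ c := by
    by_cases h : R (blockAt m A (a / m) (b / m)) = none
    · obtain ⟨u, v, hu, hv, h⟩ := hF A hA _ _ hne h
      obtain ⟨e1, e2⟩ := key _ _ h
      rw [abs_le] at hu hv
      constructor <;> rw [abs_le] <;> constructor <;> omega
    · obtain ⟨e1, e2⟩ := key _ _ h
      simp [e1, e2]
  have aux : ∀ z : ℤ, |z / (m : ℤ)| ≤ c → -(m * c : ℤ) ≤ z ∧ z ≤ m * c + m := by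
    intro z hz
    rw [abs_le] at hz
    have e := Int.mul_ediv_add_emod z m
    have h0 := Int.emod_nonneg z hm.ne'
    have h1 := Int.emod_lt_of_pos z hm
    constructor <;> nlinarith
  simp only [Finset.mem_product, Finset.mem_Icc]
  exact ⟨aux a hc.1, aux b hc.2⟩

/-- A passive seeded TA system with fewer than `n` states cannot
non-committally simulate `X_n`. -/
theorem noPassiveSim
    (n : ℕ) (Y : TASystem) (hP : Passive Y) (hcard : Y.states.card < n)
    (m : ℕ) (R : Block m → Option ℕ) :
    ¬ Simulates m R Y (X n) := by
  rintro ⟨c, -, hR, ⟨hE1, hE2⟩, hF, hFol, hMod⟩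
  have hsX : Producible (X n) seedX := Relation.ReflTransGen.refl
  -- a maximal assembly representing the seed
  obtain ⟨A, hA, hAM, hmax⟩ : ∃ A, Producible Y A ∧ RepMap m R A seedX ∧
      ∀ B, Producible Y B → RepMap m R B seedX →
        B.finite.toFinset.card ≤ A.finite.toFinset.card := by
    let P : ℕ → Prop := fun k => ∃ A, Producible Y A ∧ RepMap m R A seedX ∧
      A.finite.toFinset.card = k
    obtain ⟨A0, hA0, hA0M⟩ := hE2 _ hsX
    let N := (Finset.Icc (-(m * c : ℤ)) (m * c + m) ×ˢ
      Finset.Icc (-(m * c : ℤ)) (m * c + m)).card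
    have hb : ∀ B, Producible Y B → RepMap m R B seedX → B.finite.toFinset.card ≤ N :=
      fun B h1 h2 => Finset.card_le_card (bounded_supp hR hF h1 h2)
    obtain ⟨A, hA, hAM, hk⟩ : P (Nat.findGreatest P N) :=
      Nat.findGreatest_spec (hb A0 hA0 hA0M) ⟨A0, hA0, hA0M, rfl⟩
    refine ⟨A, hA, hAM, fun B h1 h2 => ?_⟩
    rw [hk]
    exact Nat.le_findGreatest (hb B h1 h2) ⟨B, h1, h2, rfl⟩
  -- A is nonempty
  obtain ⟨o, ho⟩ : ∃ o, A.tiles o ≠ none := by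
    by_contra hc
    push Not at hc
    have h := hAM 0 0
    have e : blockAt m A 0 0 = emptyBlock m := by
      funext ij; exact hc _
    rw [e, hR.2] at h
    simp [seedX, onePoint] at h
  have key : ∀ i ∈ Finset.Icc 1 n, ∃ (p : Pos) (σ : ℕ), σ ∈ Y.initial ∧ A.tiles p = none ∧
      StableAt Y.aff Y.temp (addTile A p σ) ∧
      R (blockAt m (addTile A p σ) 1 0) = some i := by
    intro i hi
    rw [Finset.mem_Icc] at hi
    obtain ⟨B, hAB, hBM⟩ := hMod _ _ hsX (seedDot_reach n i hi.1 hi.2) A hA hAM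
    have hne : A ≠ B := by
      rintro rfl
      have h1 := hAM 1 0
      rw [← hBM 1 0] at h1
      simp [seedX, onePoint, seedDot] at h1
    obtain ⟨C, hAC, hCB⟩ := first_attach hP hA hAB hne
    have hACr : Reach Y A C := Relation.ReflTransGen.single (Or.inl hAC)
    have hC : Producible Y C := Relation.ReflTransGen.trans hA hACr
    obtain ⟨p, σ, hσ, hp, hCt, hst⟩ := hAC
    have hCe : C = addTile A p σ := Assembly.ext_tiles hCt
    obtain ⟨C0, hC0, hCM⟩ := hE1 C hC
    have s1 := X_sub (hFol A C hA hACr _ _ hAM hCM)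
    have s2 := X_sub (hFol C B hC hCB _ _ hCM hBM)
    refine ⟨p, σ, hσ, hp, hCe ▸ hst, ?_⟩
    rw [← hCe, ← hCM 1 0]
    rcases h10 : C0.tiles (1, 0) with _ | j
    · exfalso
      have : C0 = seedX := by
        apply Assembly.ext_tiles
        funext q
        by_cases hq : q = (0, 0)
        · have := s1 (0, 0) 0 (by simp [seedX, onePoint])
          subst hq
          rw [this]; simp [seedX, onePoint]
        · rcases hq' : C0.tiles q with _ | j
          · simp only [seedX, onePoint]; rw [if_neg hq]
          · exfalso
            have h3 := s2 q j hq'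
            by_cases hq1 : q = (1, 0)
            · subst hq1; simp [h10] at hq'
            · simp [seedDot, hq, hq1] at h3
      rw [this] at hCM
      have hle := hmax C hC hCM
      have hlt : A.finite.toFinset ⊂ C.finite.toFinset := by
        have hsub : SubAsm A C := attach_sub ⟨p, σ, hσ, hp, hCt, hst⟩
        refine (Finset.ssubset_iff_of_subset (supp_mono hsub)).2 ⟨p, ?_, ?_⟩
        · simp [hCt]
        · simp [hp]
      exact absurd (Finset.card_lt_card hlt) (by omega)
    · have := s2 _ _ h10
      simpa [seedDot] using this.symm
  choose! p σ hσ hp hst hrep using key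
  have hstep : ∀ i ∈ Finset.Icc 1 n, AttachStep Y A (addTile A (p i) (σ i)) :=
    fun i hi => ⟨p i, σ i, hσ i hi, hp i hi, rfl, hst i hi⟩
  have hinj : Set.InjOn σ (Finset.Icc 1 n : Finset ℕ) := by
    intro i hi j hj hij
    rw [Finset.mem_coe] at hi hj
    by_cases hpp : p i = p j
    · have h1 := hrep i hi
      rw [hpp, hij, hrep j hj] at h1
      simpa using h1.symm
    · let D := addTile (addTile A (p i) (σ i)) (p j) (σ j)
      have hDt : D.tiles = Function.update (addTile A (p j) (σ j)).tiles (p i) (some (σ i)) :=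
        Function.update_comm hpp _ _ _
      have nj : (addTile A (p i) (σ i)).tiles (p j) = none := by
        simp only [addTile]
        rw [Function.update_of_ne (Ne.symm hpp)]; exact hp j hj
      have ni : (addTile A (p j) (σ j)).tiles (p i) = none := by
        simp only [addTile]
        rw [Function.update_of_ne hpp]; exact hp i hi
      have si : SubAsm (addTile A (p i) (σ i)) D := by
        intro q s hq
        by_cases h : q = p j
        · subst h; simp [nj] at hq
        · simp only [D]; rw [addTile]; simp only []; rw [Function.update_of_ne h]; exact hq
      have sj : SubAsm (addTile A (p j) (σ j)) D := by
        intro q s hq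
        by_cases h : q = p i
        · subst h; simp [ni] at hq
        · rw [hDt, Function.update_of_ne h]; exact hq
      have oo : ∀ i ∈ Finset.Icc 1 n, (addTile A (p i) (σ i)).tiles o ≠ none := by
        intro i hi
        have : o ≠ p i := by rintro h; exact ho (h ▸ hp i hi)
        simp only [addTile]; rw [Function.update_of_ne this]; exact ho
      have hD : StableAt Y.aff Y.temp D := by
        refine stable_union (hst i hi) (hst j hj) si sj (oo i hi) (oo j hj) ?_
        intro q hq
        by_cases h : q = p j
        · right; subst h; simp [addTile]
        · left
          have : D.tiles q = (addTile A (p i) (σ i)).tiles q := Function.update_of_ne h _ _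
          rwa [this] at hq
      have ri : Reach Y (addTile A (p i) (σ i)) D :=
        Relation.ReflTransGen.single (Or.inl ⟨p j, σ j, hσ j hj, nj, rfl, hD⟩)
      have rj : Reach Y (addTile A (p j) (σ j)) D :=
        Relation.ReflTransGen.single (Or.inl ⟨p i, σ i, hσ i hi, ni, hDt, hD⟩)
      have pr : ∀ i ∈ Finset.Icc 1 n, Producible Y (addTile A (p i) (σ i)) :=
        fun i hi => Relation.ReflTransGen.tail hA (Or.inl (hstep i hi))
      obtain ⟨D0, -, hDM⟩ := hE1 D (Relation.ReflTransGen.trans (pr i hi) ri)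
      obtain ⟨Ci, -, hCi⟩ := hE1 _ (pr i hi)
      obtain ⟨Cj, -, hCj⟩ := hE1 _ (pr j hj)
      have h1 := X_sub (hFol _ _ (pr i hi) ri _ _ hCi hDM) (1, 0) i
        ((hCi 1 0).trans (hrep i hi))
      have h2 := X_sub (hFol _ _ (pr j hj) rj _ _ hCj hDM) (1, 0) j
        ((hCj 1 0).trans (hrep j hj))
      rw [h1] at h2
      simpa using h2
  have := Finset.card_le_card_of_injOn σ
    (fun i hi => Y.initial_sub (hσ i hi)) hinj
  simp at this
  omega
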